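/- Let n≥1, ν>0, and let X_1,…,X_n be ℕ-valued random variables (not necessarily independent), each having the Poisson distribution of parameter ν. Then for every u>0, E[ max_{1≤i≤n} X_i ] ≤ ν + ( log n + ν(e^u − u − 1) ) / u. -/

import Mathlib

open MeasureTheory

/-- The moment generating series of the Poisson distribution. -/
lemma hasSum_poisson_mul_exp (r u : ℝ) :
    HasSum (fun k : ℕ ↦ Real.exp (-r) * r ^ k / (Nat.factorial k) * Real.exp (u * k))
      (Real.exp (r * (Real.exp u - 1))) := by
  have h := (NormedSpace.expSeries_div_hasSum_exp (r * Real.exp u)).mul_left (Real.exp (-r))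
  rw [← Real.exp_eq_exp_ℝ, ← Real.exp_add] at h
  have hfun : (fun k : ℕ ↦ Real.exp (-r) * r ^ k / (Nat.factorial k) * Real.exp (u * k)) =
      fun k ↦ Real.exp (-r) * ((r * Real.exp u) ^ k / (Nat.factorial k)) := by
    ext k
    rw [mul_pow, ← Real.exp_nat_mul, mul_comm u]
    ring
  rw [hfun, show r * (Real.exp u - 1) = -r + r * Real.exp u by ring]
  exact h

open ProbabilityTheory in
lemma integrable_exp_mul_poissonMeasure (r : NNReal) (u : ℝ) :
    Integrable (fun k : ℕ ↦ Real.exp (u * k)) (poissonMeasure r) := by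
  rw [integrable_poissonMeasure_iff]
  simpa only [Real.norm_eq_abs, Real.abs_exp] using (hasSum_poisson_mul_exp r u).summable

open ProbabilityTheory in
lemma integral_exp_mul_poissonMeasure (r : NNReal) (u : ℝ) :
    ∫ k : ℕ, Real.exp (u * k) ∂(poissonMeasure r) = Real.exp (r * (Real.exp u - 1)) := by
  rw [integral_poissonMeasure]
  exact (hasSum_poisson_mul_exp r u).tsum_eq

/-- A maximal inequality: a uniform bound `exp c` on the exponential moments at `u` bounds the
expectation of the maximum of nonnegative random variables by `(log n + c) / u`. -/
lemma integral_iSup_le_of_integral_exp_le {Ω : Type*} [MeasurableSpace Ω] (μ : Measure Ω)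
    [IsProbabilityMeasure μ] {n : ℕ} (hn : 1 ≤ n) {Y : Fin n → Ω → ℝ}
    (hY : ∀ i ω, 0 ≤ Y i ω) {u c : ℝ} (hu : 0 < u)
    (hint : ∀ i, Integrable (fun ω ↦ Real.exp (u * Y i ω)) μ)
    (hle : ∀ i, ∫ ω, Real.exp (u * Y i ω) ∂μ ≤ Real.exp c) :
    ∫ ω, (⨆ i, Y i ω) ∂μ ≤ (Real.log n + c) / u := by
  have : Nonempty (Fin n) := ⟨⟨0, hn⟩⟩
  have hn' : (0 : ℝ) < n := by exact_mod_cast hn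
  set S := Real.log n + c with hS
  have hsum : Integrable (fun ω ↦ ∑ i, Real.exp (u * Y i ω)) μ :=
    integrable_finsetSum _ fun i _ ↦ hint i
  have hbound : Integrable
      (fun ω ↦ (Real.exp (-S) * ∑ i, Real.exp (u * Y i ω) + (S - 1)) / u) μ :=
    ((hsum.const_mul _).add (integrable_const _)).div_const u
  calc ∫ ω, (⨆ i, Y i ω) ∂μ
      ≤ ∫ ω, (Real.exp (-S) * ∑ i, Real.exp (u * Y i ω) + (S - 1)) / u ∂μ := by
        refine integral_mono_of_nonneg (.of_forall fun ω ↦ Real.iSup_nonneg fun i ↦ hY i ω)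
          hbound (.of_forall fun ω ↦ ?_)
        refine ciSup_le fun i ↦ ?_
        rw [le_div_iff₀ hu]
        have h1 := Real.add_one_le_exp (-S + u * Y i ω)
        have h2 : Real.exp (u * Y i ω) ≤ ∑ j, Real.exp (u * Y j ω) :=
          Finset.single_le_sum (f := fun j ↦ Real.exp (u * Y j ω))
            (fun j _ ↦ (Real.exp_pos _).le) (Finset.mem_univ i)
        have h3 := mul_le_mul_of_nonneg_left h2 (Real.exp_pos (-S)).le
        rw [Real.exp_add] at h1
        linarith
    _ = (Real.exp (-S) * ∑ i, ∫ ω, Real.exp (u * Y i ω) ∂μ + (S - 1)) / u := by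
        rw [integral_div, integral_add (hsum.const_mul _) (integrable_const _),
          integral_const_mul, integral_finsetSum _ fun i _ ↦ hint i]
        simp
    _ ≤ S / u := by
        have h1 : ∑ i, ∫ ω, Real.exp (u * Y i ω) ∂μ ≤ Real.exp S := by
          calc ∑ i, ∫ ω, Real.exp (u * Y i ω) ∂μ ≤ ∑ _i : Fin n, Real.exp c :=
                Finset.sum_le_sum fun i _ ↦ hle i
            _ = Real.exp S := by simp [hS, Real.exp_add, Real.exp_log hn']
        have h2 := mul_le_mul_of_nonneg_left h1 (Real.exp_pos (-S)).le
        rw [← Real.exp_add, neg_add_cancel, Real.exp_zero] at h2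
        gcongr
        linarith

open ProbabilityTheory in
lemma map_eq_poissonMeasure {Ω : Type*} [MeasurableSpace Ω] {μ : Measure Ω} {r : NNReal}
    {X : Ω → ℕ} (hX : Measurable X)
    (hdist : ∀ k : ℕ,
      μ {ω | X ω = k} = ENNReal.ofReal (Real.exp (-r) * r ^ k / (Nat.factorial k))) :
    μ.map X = poissonMeasure r := by
  refine Measure.ext_of_singleton fun k ↦ ?_
  rw [Measure.map_apply hX (measurableSet_singleton k), poissonMeasure_singleton, ← hdist k]
  rfl

/-- If `X_1, …, X_n` are (not necessarily independent) Poisson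
random variables of parameter `ν`, then for every `u > 0`,
`E[max_i X_i] ≤ ν + (log n + ν (e^u − u − 1)) / u`. -/
theorem expectation_max_poisson_le
    {Ω : Type*} [MeasurableSpace Ω] (μ : Measure Ω) [IsProbabilityMeasure μ]
    (n : ℕ) (hn : 1 ≤ n) (ν : ℝ) (hν : 0 < ν)
    (X : Fin n → Ω → ℕ) (hmeas : ∀ i, Measurable (X i))
    (hdist : ∀ i, ∀ k : ℕ,
      μ {ω | X i ω = k} = ENNReal.ofReal (Real.exp (-ν) * ν ^ k / (Nat.factorial k))) :
    ∀ u : ℝ, 0 < u →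
      (∫ ω, (⨆ i : Fin n, (X i ω : ℝ)) ∂μ)
        ≤ ν + (Real.log n + ν * (Real.exp u - u - 1)) / u := by
  intro u hu
  lift ν to NNReal using hν.le
  have hmap i := map_eq_poissonMeasure (hmeas i) (hdist i)
  have hint i : Integrable (fun ω ↦ Real.exp (u * X i ω)) μ := by
    have h := integrable_exp_mul_poissonMeasure ν u
    rw [← hmap i] at h
    exact h.comp_measurable (hmeas i)
  have hmgf i : ∫ ω, Real.exp (u * X i ω) ∂μ = Real.exp (ν * (Real.exp u - 1)) := by
    rw [← integral_exp_mul_poissonMeasure, ← hmap i,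
      integral_map (hmeas i).aemeasurable .of_discrete]
  calc ∫ ω, (⨆ i : Fin n, (X i ω : ℝ)) ∂μ
      ≤ (Real.log n + ν * (Real.exp u - 1)) / u :=
        integral_iSup_le_of_integral_exp_le μ hn (fun i ω ↦ Nat.cast_nonneg _) hu hint
          fun i ↦ (hmgf i).le
    _ = ν + (Real.log n + ν * (Real.exp u - u - 1)) / u := by
        field_simp
        ring
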